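/- Let n be a positive integer and let D be an infinite division ring, viewed as a first-order structure in the language of rings, satisfying (†)_n. Then D has dimension at most n as a vector space over its center Z(D). -/

import Mathlib

/-- The chain condition (†)_n: for any definable additive subgroups H_0, …, H_n of (D,+), there
is some j ≤ n such that ⋂_{i≤n} H_i has finite index in ⋂_{i≠j} H_i. -/
def SatisfiesDagger (D : Type*) [DivisionRing D] [FirstOrder.Ring.CompatibleRing D]
    (n : ℕ) : Prop :=
  ∀ H : Fin (n + 1) → AddSubgroup D,
    (∀ i, Set.Definable₁ (Set.univ : Set D) FirstOrder.Language.ring (H i : Set D)) →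
    ∃ j : Fin (n + 1),
      ((⨅ i, H i).addSubgroupOf (⨅ i ∈ ({j}ᶜ : Set (Fin (n + 1))), H i)).index ≠ 0

open Polynomial in
/-- If a product of factors `X - λ` evaluated at `f` kills a nonzero vector, then one of the `λ` is
an eigenvalue of `f`. -/
theorem Module.End.exists_eigenvector_of_prod_apply_eq_zero {F V : Type*} [Field F]
    [AddCommGroup V] [Module F V] (f : Module.End F V) (s : Finset F) (y : V) (hy : y ≠ 0)
    (h : aeval f (∏ c ∈ s, (X - C c)) y = 0) : ∃ c ∈ s, ∃ w ≠ 0, f w = c • w := by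
  classical
  induction s using Finset.induction_on with
  | empty => simp [hy] at h
  | insert c s hc ih =>
    by_cases hs : aeval f (∏ c ∈ s, (X - C c)) y = 0
    · obtain ⟨d, hd, w⟩ := ih hs
      exact ⟨d, Finset.mem_insert_of_mem hd, w⟩
    · refine ⟨c, Finset.mem_insert_self _ _, _, hs, ?_⟩
      rw [Finset.prod_insert hc, map_mul, Module.End.mul_apply] at h
      simpa [sub_eq_zero, Module.algebraMap_end_apply] using h

open Polynomial in
/-- An element of a division ring generating a finite subring and not commuting with `x` has a
conjugate in that subring different from itself. -/
theorem Subring.exists_conj_ne_of_finite_closure {D : Type*} [DivisionRing D] {a x : D}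
    (hfin : (Subring.closure {a} : Set D).Finite) (hx : x * a ≠ a * x) :
    ∃ c ∈ Subring.closure {a}, c ≠ a ∧ ∃ w ≠ 0, w * a = c * w := by
  classical
  have : Finite (Subring.closure {a}) := hfin
  let _ : Field (Subring.closure {a}) := (Finite.isDomain_to_isField _).toField
  have := Fintype.ofFinite (Subring.closure {a})
  let a' : Subring.closure {a} := ⟨a, Subring.subset_closure rfl⟩
  let f : Module.End (Subring.closure {a}) D :=
    { toFun := fun y => y * a
      map_add' := fun y z => add_mul y z a
      map_smul' := fun c y => by simp [Subring.smul_def, mul_assoc] }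
  have hf (k : ℕ) (y : D) : (f ^ k) y = y * a ^ k := by
    induction k generalizing y with
    | zero => simp
    | succ k ih => rw [pow_succ, Module.End.mul_apply, ih]; simp [f, pow_succ', mul_assoc]
  have hprod : (X ^ Fintype.card (Subring.closure {a}) - X : (Subring.closure {a})[X]) =
      (∏ c ∈ Finset.univ.erase a', (X - C c)) * (X - C a') := by
    rw [mul_comm, Finset.mul_prod_erase _ (fun c => X - C c) (Finset.mem_univ a')]
    have hroots := FiniteField.roots_X_pow_card_sub_X (Subring.closure {a})
    have hdeg := FiniteField.X_pow_card_sub_X_natDegree_eq (Subring.closure {a})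
      (Fintype.one_lt_card (α := Subring.closure {a}))
    have hmonic : (X ^ Fintype.card (Subring.closure {a}) - X : (Subring.closure {a})[X]).Monic :=
      monic_X_pow_sub (by rw [degree_X]; exact_mod_cast Fintype.one_lt_card)
    rw [← prod_multiset_X_sub_C_of_monic_of_roots_card_eq hmonic (by rw [hroots, hdeg]; rfl),
      hroots]
    rfl
  have hq : a ^ Fintype.card (Subring.closure {a}) = a :=
    congrArg Subtype.val (FiniteField.pow_card a')
  have key : aeval f (∏ c ∈ Finset.univ.erase a', (X - C c)) (x * a - a * x) = 0 := by
    have h1 : aeval f (X ^ Fintype.card (Subring.closure {a}) - X : (Subring.closure {a})[X]) x = 0 := by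
      simp [hf, hq, f]
    rw [hprod, map_mul, Module.End.mul_apply] at h1
    simpa [f, a', Subring.smul_def] using h1
  obtain ⟨c, hc, w, hw, hcw⟩ :=
    f.exists_eigenvector_of_prod_apply_eq_zero _ _ (sub_ne_zero.2 hx) key
  refine ⟨c, c.2, fun h => (Finset.ne_of_mem_erase hc) (Subtype.ext h), w, hw, hcw⟩

/-- A finite subring `F` and an element `w` with finitely many powers such that `w F ⊆ F w` lie in a
common finite subring. -/
theorem Subring.exists_finite_of_semicommute {D : Type*} [Ring D] (F : Subring D) [Finite F]
    (w : D) (hw : (Set.range fun k : ℕ => w ^ k).Finite)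
    (hwF : ∀ b ∈ F, ∃ b' ∈ F, w * b = b' * w) :
    ∃ S : Subring D, F ≤ S ∧ w ∈ S ∧ Finite S := by
  let M : Submodule F D := Submodule.span F (Set.range fun k : ℕ => w ^ k)
  have hpow (k : ℕ) : w ^ k ∈ M := Submodule.subset_span ⟨k, rfl⟩
  have : Module.Finite F M := Module.Finite.span_of_finite F hw
  have : Finite M := Module.finite_of_finite F
  have hwM (u : D) (hu : u ∈ M) : w * u ∈ M := by
    induction hu using Submodule.span_induction with
    | mem u hu =>
      obtain ⟨k, rfl⟩ := hu
      simpa only [pow_succ'] using hpow (k + 1)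
    | zero => simp
    | add u v _ _ hu hv => rw [mul_add]; exact add_mem hu hv
    | smul b u _ hu =>
      obtain ⟨b', hb', h⟩ := hwF b b.2
      have : w * (b • u) = (⟨b', hb'⟩ : F) • (w * u) := by
        simp only [Subring.smul_def, smul_eq_mul, ← mul_assoc, h]
      rw [this]
      exact M.smul_mem _ hu
  have hpowM (k : ℕ) (u : D) (hu : u ∈ M) : w ^ k * u ∈ M := by
    induction k with
    | zero => simpa
    | succ k ih => rw [pow_succ', mul_assoc]; exact hwM _ ih
  have hmul (v u : D) (hv : v ∈ M) (hu : u ∈ M) : v * u ∈ M := by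
    induction hv using Submodule.span_induction with
    | mem v hv => obtain ⟨k, rfl⟩ := hv; exact hpowM k u hu
    | zero => simp
    | add v v' _ _ h h' => rw [add_mul]; exact add_mem h h'
    | smul b v _ h => rw [smul_mul_assoc]; exact M.smul_mem _ h
  have hone : (1 : D) ∈ M := pow_zero w ▸ hpow 0
  refine ⟨{ M.toAddSubgroup with one_mem' := hone, mul_mem' := hmul _ _ }, fun b hb => ?_,
    (pow_one w ▸ hpow 1 : w ∈ M), ‹Finite M›⟩
  have h := M.smul_mem (⟨b, hb⟩ : F) hone
  rw [Subring.smul_def, smul_eq_mul, mul_one] at h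
  exact h

/-- A division ring in which every element generates a finite subring is commutative. -/
theorem mul_comm_of_finite_closure {D : Type*} [DivisionRing D]
    (hfin : ∀ a : D, (Subring.closure {a} : Set D).Finite) (x a : D) : x * a = a * x := by
  by_contra hx
  obtain ⟨c, hc, hca, w, hw, hwc⟩ := Subring.exists_conj_ne_of_finite_closure (hfin a) hx
  have : Finite (Subring.closure {a}) := hfin a
  have hwF (b : D) (hb : b ∈ Subring.closure {a}) :
      ∃ b' ∈ Subring.closure {a}, w * b = b' * w := by
    induction hb using Subring.closure_induction with
    | mem b hb => rw [Set.mem_singleton_iff.1 hb]; exact ⟨c, hc, hwc⟩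
    | zero => exact ⟨0, zero_mem _, by simp⟩
    | one => exact ⟨1, one_mem _, by simp⟩
    | add b d _ _ hb hd =>
      obtain ⟨b', hb', h⟩ := hb
      obtain ⟨d', hd', h'⟩ := hd
      exact ⟨b' + d', add_mem hb' hd', by rw [mul_add, h, h', add_mul]⟩
    | neg b _ hb =>
      obtain ⟨b', hb', h⟩ := hb
      exact ⟨-b', neg_mem hb', by rw [mul_neg, h, neg_mul]⟩
    | mul b d _ _ hb hd =>
      obtain ⟨b', hb', h⟩ := hb
      obtain ⟨d', hd', h'⟩ := hd
      exact ⟨b' * d', mul_mem hb' hd', by rw [← mul_assoc, h, mul_assoc, h', mul_assoc]⟩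
  have hpow : (Set.range fun k : ℕ => w ^ k).Finite := by
    refine (hfin w).subset (Set.range_subset_iff.2 fun k => ?_)
    exact pow_mem (Subring.subset_closure (Set.mem_singleton w)) k
  obtain ⟨S, hFS, hwS, hS⟩ := Subring.exists_finite_of_semicommute _ w hpow hwF
  have haS : a ∈ S := hFS (Subring.subset_closure (Set.mem_singleton a))
  have hcomm : w * a = a * w :=
    congrArg Subtype.val ((Finite.isDomain_to_isField S).mul_comm ⟨w, hwS⟩ ⟨a, haS⟩)
  exact hca (mul_right_cancel₀ hw (hwc.symm.trans hcomm))

open FirstOrder Language in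
/-- The ring of additive endomorphisms of `D` given by terms with parameters in `D`. -/
def termEnd (D : Type*) [DivisionRing D] [FirstOrder.Ring.CompatibleRing D] :
    Subring (AddMonoid.End D) where
  carrier := {f | ∃ t : Language.ring.Term ((Set.univ : Set D) ⊕ Fin 1),
    ∀ v : Fin 1 → D, t.realize (Sum.elim (↑) v) = f (v 0)}
  zero_mem' := ⟨0, by simp⟩
  one_mem' := ⟨Term.var (Sum.inr 0), by simp⟩
  add_mem' := by
    rintro f g ⟨t, ht⟩ ⟨s, hs⟩
    exact ⟨t + s, fun v => by rw [FirstOrder.Ring.realize_add, ht, hs]; rfl⟩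
  neg_mem' := by
    rintro f ⟨t, ht⟩
    exact ⟨-t, fun v => by rw [FirstOrder.Ring.realize_neg, ht]; rfl⟩
  mul_mem' := by
    rintro f g ⟨t, ht⟩ ⟨s, hs⟩
    refine ⟨t.subst (Sum.elim (fun c => Term.var (Sum.inl c)) fun _ => s), fun v => ?_⟩
    rw [Term.realize_subst, show (f * g) (v 0) = f (g (v 0)) from rfl, ← hs v, ← ht fun _ => s.realize _]
    congr 1
    ext (c | i) <;> simp

section termEnd

variable {D : Type*} [DivisionRing D] [FirstOrder.Ring.CompatibleRing D]

theorem mulLeft_mem_termEnd (d : D) : AddMonoidHom.mulLeft d ∈ termEnd D :=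
  ⟨FirstOrder.Language.Term.var (Sum.inl ⟨d, trivial⟩) *
    FirstOrder.Language.Term.var (Sum.inr 0), fun v => by simp; rfl⟩

theorem mulRight_mem_termEnd (d : D) : AddMonoidHom.mulRight d ∈ termEnd D :=
  ⟨FirstOrder.Language.Term.var (Sum.inr 0) *
    FirstOrder.Language.Term.var (Sum.inl ⟨d, trivial⟩), fun v => by simp; rfl⟩

theorem definable_ker_of_mem_termEnd {f : AddMonoid.End D} (hf : f ∈ termEnd D) :
    Set.Definable₁ (Set.univ : Set D) FirstOrder.Language.ring
      (AddMonoidHom.ker f : Set D) := by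
  obtain ⟨t, ht⟩ := hf
  refine Set.definable_iff_exists_formula_sum.2 ⟨t.equal 0, ?_⟩
  ext v
  simp [FirstOrder.Language.Formula.realize_equal, ht]
  rfl

/-- `D` is a simple module over every ring of additive endomorphisms containing the left
multiplications. -/
theorem isSimpleModule_of_mulLeft_mem {D : Type*} [DivisionRing D] {R : Subring (AddMonoid.End D)}
    (hR : ∀ d, AddMonoidHom.mulLeft d ∈ R) : IsSimpleModule R D := by
  refine isSimpleModule_iff_toSpanSingleton_surjective.2 ⟨inferInstance, fun x hx y => ?_⟩
  refine ⟨⟨_, hR (y * x⁻¹)⟩, ?_⟩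
  change y * x⁻¹ * x = y
  simp [hx]

/-- Under the chain condition, `D` has dimension at most `n` over its endomorphism ring as a module
over a ring of term-definable endomorphisms, if this endomorphism ring is infinite. -/
theorem SatisfiesDagger.rank_end_le {n : ℕ} (hdag : SatisfiesDagger D n)
    {R : Subring (AddMonoid.End D)} (hR : ∀ d, AddMonoidHom.mulLeft d ∈ R)
    (hRt : R ≤ termEnd D) [Infinite (Module.End R D)] :
    Module.rank (Module.End R D) D ≤ n := by
  classical
  have := isSimpleModule_of_mulLeft_mem hR
  by_contra! hlt
  have hle : ((n + 1 : ℕ) : Cardinal) ≤ Module.rank (Module.End R D) D := by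
    rw [Nat.cast_succ]; exact Order.succ_le_of_lt hlt |>.trans' (by simp)
  obtain ⟨e, he⟩ := Module.le_rank_iff.1 hle
  obtain ⟨g, hg⟩ := (Fintype.linearCombination (Module.End R D) e).exists_leftInverse_of_injective
    (LinearMap.ker_eq_bot.2 (he.fintypeLinearCombination_injective))
  have hge (i : Fin (n + 1)) : g (e i) = Pi.single i 1 := by
    simpa using LinearMap.congr_fun hg (Pi.single i 1)
  have hdens (i : Fin (n + 1)) : ∃ r : R, ∀ j, r • e j = if j = i then 1 else 0 := by
    let f : Module.End (Module.End R D) D :=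
      (LinearMap.toSpanSingleton (Module.End R D) D 1).comp ((LinearMap.proj i).comp g)
    obtain ⟨r, hr⟩ := jacobson_density f (Finset.univ.image e)
    refine ⟨r, fun j => ?_⟩
    rw [← hr _ (by simp)]
    by_cases h : j = i
    · subst h; simp [f, hge]
    · simp [f, hge, h, Ne.symm h]
  choose r hr using hdens
  obtain ⟨j, hj⟩ := hdag (fun i => AddMonoidHom.ker (r i : AddMonoid.End D))
    fun i => definable_ker_of_mem_termEnd (hRt (r i).2)
  have happly (i : Fin (n + 1)) (φ : Module.End R D) (k : Fin (n + 1)) :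
      (r i : AddMonoid.End D) (φ (e k)) = if k = i then φ 1 else 0 := by
    change r i • φ (e k) = _
    rw [← map_smul, hr]
    split_ifs <;> simp
  let K := ⨅ i ∈ ({j}ᶜ : Set (Fin (n + 1))), AddMonoidHom.ker (r i : AddMonoid.End D)
  have hmem (φ : Module.End R D) : φ (e j) ∈ K := by
    simp only [K, AddSubgroup.mem_iInf]
    intro i hi
    change (r i : AddMonoid.End D) (φ (e j)) = 0
    rw [happly, if_neg (Ne.symm hi)]
  let q (φ : Module.End R D) : K ⧸ ((⨅ i, AddMonoidHom.ker
      (r i : AddMonoid.End D)).addSubgroupOf K) := QuotientAddGroup.mk ⟨φ (e j), hmem φ⟩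
  have hq : Function.Injective q := by
    intro φ ψ h
    have h1 := QuotientAddGroup.eq.1 h
    rw [AddSubgroup.mem_addSubgroupOf, AddSubgroup.mem_iInf] at h1
    have h2 : (r j : AddMonoid.End D) (-φ (e j) + ψ (e j)) = 0 := h1 j
    rw [map_add, map_neg, happly, happly, if_pos rfl, if_pos rfl, neg_add_eq_zero] at h2
    by_contra hne
    rcases (LinearMap.bijective_or_eq_zero (φ - ψ)) with hb | hb
    · exact one_ne_zero (hb.1 (show (φ - ψ) (1 : D) = (φ - ψ) 0 by simp [h2]))
    · exact hne (sub_eq_zero.1 hb)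
  have : Infinite (K ⧸ ((⨅ i, AddMonoidHom.ker (r i : AddMonoid.End D)).addSubgroupOf K)) :=
    Infinite.of_injective q hq
  exact hj (by rw [AddSubgroup.index]; exact Nat.card_eq_zero_of_infinite)

variable (D) in
/-- The ring of term-definable additive endomorphisms of `D` that are linear for the right action
of the centralizer of `S`. -/
def linearTermEnd (S : Set D) : Subring (AddMonoid.End D) :=
  termEnd D ⊓ Subring.centralizer (AddMonoidHom.mulRight '' (Subring.centralizer S : Set D))

theorem mulLeft_mem_linearTermEnd (S : Set D) (d : D) :
    AddMonoidHom.mulLeft d ∈ linearTermEnd D S := by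
  refine ⟨mulLeft_mem_termEnd d, Subring.mem_centralizer_iff.2 ?_⟩
  rintro _ ⟨c, -, rfl⟩
  exact AddMonoidHom.ext fun x => mul_assoc d x c

theorem mulRight_mem_linearTermEnd {S : Set D} {s : D} (hs : s ∈ S) :
    AddMonoidHom.mulRight s ∈ linearTermEnd D S := by
  refine ⟨mulRight_mem_termEnd s, Subring.mem_centralizer_iff.2 ?_⟩
  rintro _ ⟨c, hc, rfl⟩
  refine AddMonoidHom.ext fun x => ?_
  change x * s * c = x * c * s
  rw [mul_assoc, mul_assoc, Subring.mem_centralizer_iff.1 hc s hs]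

/-- Right multiplication by an element of the centralizer of `S`. -/
def centralizerToEnd (S : Set D) (c : Subring.centralizer S) :
    Module.End (linearTermEnd D S) D where
  toFun x := x * c
  map_add' x y := add_mul x y c
  map_smul' r x := by
    have h := Subring.mem_centralizer_iff.1 r.2.2 _ ⟨c, c.2, rfl⟩
    exact DFunLike.congr_fun h x

theorem centralizerToEnd_bijective (S : Set D) :
    Function.Bijective (centralizerToEnd S) := by
  refine ⟨fun c c' h => Subtype.ext ?_, fun φ => ?_⟩
  · have h1 : 1 * (c : D) = 1 * c' := DFunLike.congr_fun h 1
    rwa [one_mul, one_mul] at h1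
  · have hmul (x y : D) : φ (x * y) = x * φ y :=
      φ.map_smul ⟨_, mulLeft_mem_linearTermEnd S x⟩ y
    have hmul' (s : D) (hs : s ∈ S) (y : D) : φ (y * s) = φ y * s :=
      φ.map_smul ⟨_, mulRight_mem_linearTermEnd hs⟩ y
    refine ⟨⟨φ 1, Subring.mem_centralizer_iff.2 fun s hs => ?_⟩, LinearMap.ext fun x => ?_⟩
    · rw [← hmul, ← hmul' s hs, one_mul, mul_one]
    · change x * φ 1 = φ x
      rw [← hmul, mul_one]

/-- Under the chain condition, `D` has dimension at most `n` over the centralizer of `S`, acting by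
right multiplication, if this centralizer is infinite. -/
theorem SatisfiesDagger.rank_end_linearTermEnd_le {n : ℕ} (hdag : SatisfiesDagger D n) (S : Set D)
    [Infinite (Subring.centralizer S)] :
    Module.rank (Module.End (linearTermEnd D S) D) D ≤ n :=
  have := Infinite.of_injective _ (centralizerToEnd_bijective S).1
  hdag.rank_end_le (mulLeft_mem_linearTermEnd S) inf_le_left

/-- Under the chain condition, `D` has dimension at most `n` over its center, if this center is
infinite. -/
theorem SatisfiesDagger.rank_center_le {n : ℕ} (hdag : SatisfiesDagger D n)
    [Infinite (Subring.center D)] : Module.rank (Subring.center D) D ≤ n := by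
  have hcen : Subring.centralizer (Set.univ : Set D) = Subring.center D :=
    Subring.centralizer_univ
  have : Infinite (Subring.centralizer (Set.univ : Set D)) := by rwa [hcen]
  refine le_trans ?_ (hdag.rank_end_linearTermEnd_le Set.univ)
  refine rank_le_of_surjective_injective
    (fun c => centralizerToEnd Set.univ ⟨c, hcen.symm ▸ c.2⟩) (AddMonoidHom.id D)
    (fun φ => ?_) Function.injective_id fun c x => ?_
  · obtain ⟨c, rfl⟩ := (centralizerToEnd_bijective Set.univ).2 φ
    exact ⟨⟨c, hcen ▸ c.2⟩, rfl⟩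
  · exact (Subring.mem_center_iff.1 c.2 x).symm

end termEnd

/-- If the `v i` are linearly independent over the center of `D`, then a map
`x ↦ ∑ i, d i * x * v i` vanishes only if all `d i` do. -/
theorem LinearIndependent.eq_zero_of_sum_mul_mul_eq_zero {D ι : Type*} [DivisionRing D]
    {v : ι → D} (hv : LinearIndependent (Subring.center D) v) (s : Finset ι) (d : ι → D)
    (h : ∀ x, ∑ i ∈ s, d i * x * v i = 0) : ∀ i ∈ s, d i = 0 := by
  classical
  induction s using Finset.induction_on generalizing d with
  | empty => simp
  | insert k s hk ih =>
    by_cases hdk : d k = 0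
    · have h0 := ih d fun x => by simpa [hk, hdk] using h x
      simpa [hdk] using h0
    · exfalso
      let e (i : ι) : D := (d k)⁻¹ * d i
      have he (x : D) : x * v k + ∑ i ∈ s, e i * x * v i = 0 := by
        have h1 := congrArg ((d k)⁻¹ * ·) (h x)
        simpa [Finset.sum_insert hk, mul_add, Finset.mul_sum, ← mul_assoc, hdk, e] using h1
      have hcomm (y : D) : ∀ i ∈ s, e i * y - y * e i = 0 := by
        refine ih _ fun x => ?_
        have h1 := he (y * x)
        have h2 := congrArg (y * ·) (he x)
        simp only [mul_add, Finset.mul_sum, mul_zero, ← mul_assoc] at h1 h2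
        simpa [sub_mul, Finset.sum_sub_distrib] using sub_eq_zero.2 (h1.trans h2.symm)
      refine hv.notMem_span_image (s := (s : Set ι)) (x := k) (by simpa using hk) ?_
      have hvk : v k = -∑ i ∈ s, e i * v i := by
        simpa [eq_neg_iff_add_eq_zero] using he 1
      rw [hvk]
      refine neg_mem (sum_mem fun i hi => ?_)
      exact Submodule.smul_mem _ (⟨e i, Subring.mem_center_iff.2 fun y =>
        (sub_eq_zero.1 (hcomm y i hi)).symm⟩ : Subring.center D)
        (Submodule.subset_span ⟨i, hi, rfl⟩)

/-- In a division ring with finite center, every element algebraic over the center generates a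
finite subring. -/
theorem Subring.finite_closure_of_not_linearIndependent_pow {D : Type*} [DivisionRing D]
    [Finite (Subring.center D)] {a : D}
    (ha : ¬ LinearIndependent (Subring.center D) fun k : ℕ => a ^ k) :
    (Subring.closure {a} : Set D).Finite := by
  have halg : IsAlgebraic (Subring.center D) a := by
    by_contra h
    refine ha ?_
    have h1 := transcendental_iff_injective.1 h
    have h2 := (Polynomial.basisMonomials (Subring.center D)).linearIndependent.map_injOn
      (Polynomial.aeval a).toLinearMap h1.injOn
    simpa [Function.comp_def] using h2
  have := Algebra.finite_adjoin_simple_of_isIntegral halg.isIntegral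
  have : Finite (Algebra.adjoin (Subring.center D) {a}) := Module.finite_of_finite (Subring.center D)
  refine Set.Finite.subset (s := (Algebra.adjoin (Subring.center D) {a} : Set D)) this ?_
  exact Subring.closure_le (t := (Algebra.adjoin (Subring.center D) {a}).toSubring).2
    Algebra.subset_adjoin

/-- Under the chain condition, every element of `D` with infinite centralizer is algebraic over the
center. -/
theorem SatisfiesDagger.not_linearIndependent_pow {D : Type*} [DivisionRing D]
    [FirstOrder.Ring.CompatibleRing D] {n : ℕ} (hdag : SatisfiesDagger D n) (a : D)
    [Infinite (Subring.centralizer {a})] :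
    ¬ LinearIndependent (Subring.center D) fun k : ℕ => a ^ k := by
  classical
  intro hind
  have := isSimpleModule_of_mulLeft_mem (mulLeft_mem_linearTermEnd (D := D) {a})
  have hrank := hdag.rank_end_linearTermEnd_le {a}
  have hfin : Module.Finite (Module.End (linearTermEnd D {a}) D) D :=
    Module.rank_lt_aleph0_iff.1 (hrank.trans_lt (Cardinal.natCast_lt_aleph0))
  let b := Module.finBasis (Module.End (linearTermEnd D {a}) D) D
  have hcard : Module.finrank (Module.End (linearTermEnd D {a}) D) D ≤ n :=
    Module.finrank_le_of_rank_le hrank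
  let L : (Fin (n + 1) → D) →ₗ[D]
      (Fin (Module.finrank (Module.End (linearTermEnd D {a}) D) D) → D) :=
    LinearMap.pi fun j => Fintype.linearCombination D fun k : Fin (n + 1) => b j * a ^ (k : ℕ)
  obtain ⟨d, hdL, hd⟩ : ∃ d, L d = 0 ∧ d ≠ 0 := by
    by_contra! h
    have := LinearMap.finrank_le_finrank_of_injective ((injective_iff_map_eq_zero L).2 h)
    simp at this
    omega
  have hpow (k : ℕ) : AddMonoidHom.mulRight (a ^ k) ∈ linearTermEnd D {a} := by
    induction k with
    | zero =>
      have h : AddMonoidHom.mulRight (a ^ 0) = (1 : AddMonoid.End D) :=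
        AddMonoidHom.ext fun x => (congrArg (x * ·) (pow_zero a)).trans (mul_one x)
      exact h ▸ one_mem _
    | succ k ih =>
      have h : AddMonoidHom.mulRight (a ^ (k + 1)) =
          (AddMonoidHom.mulRight (a ^ k)).comp (AddMonoidHom.mulRight a) :=
        AddMonoidHom.ext fun x =>
          (congrArg (x * ·) (pow_succ' a k)).trans (mul_assoc x a (a ^ k)).symm
      rw [h]
      exact mul_mem ih (mulRight_mem_linearTermEnd (Set.mem_singleton a))
  let r : linearTermEnd D {a} := ∑ k, ⟨_, mulLeft_mem_linearTermEnd {a} (d k)⟩ * ⟨_, hpow k⟩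
  have hr (x : D) : r • x = ∑ k, d k * x * a ^ (k : ℕ) := by
    simp only [r, Finset.sum_smul, mul_smul]
    exact Finset.sum_congr rfl fun k _ => (mul_assoc _ _ _).symm
  have hzero (x : D) : r • x = 0 := by
    rw [← b.sum_repr x, Finset.smul_sum]
    refine Finset.sum_eq_zero fun j _ => ?_
    have hbj : r • b j = 0 := by
      rw [hr]
      simpa [L, Fintype.linearCombination_apply, mul_assoc] using congrFun hdL j
    rw [Module.End.smul_def, ← map_smul, hbj, map_zero]
  have hind' := hind.comp (fun k : Fin (n + 1) => (k : ℕ)) Fin.val_injective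
  have := hind'.eq_zero_of_sum_mul_mul_eq_zero Finset.univ d fun x => (hr x).symm.trans (hzero x)
  exact hd (funext fun k => this k (Finset.mem_univ k))

/-- Let n be a positive integer and D an infinite division ring, viewed as a first-order
structure in the language of rings, satisfying (†)_n. Then D has dimension at most n as a
vector space over its center Z(D). -/
theorem stmt_9 (n : ℕ) (hn : 0 < n) (D : Type*) [DivisionRing D] [Infinite D]
    [FirstOrder.Ring.CompatibleRing D]
    (hdag : SatisfiesDagger D n) :
    Module.rank (Subring.center D) D ≤ n := by
  rcases finite_or_infinite (Subring.center D) with hfin | hinf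
  · exfalso
    have hclosure (a : D) : (Subring.closure {a} : Set D).Finite := by
      rcases finite_or_infinite (Subring.centralizer {a}) with h | h
      · refine Set.Finite.subset (s := (Subring.centralizer {a} : Set D)) h ?_
        refine Subring.closure_le.2 (Set.singleton_subset_iff.2 ?_)
        exact Subring.mem_centralizer_iff.2 fun s hs => by rw [Set.mem_singleton_iff.1 hs]
      · exact Subring.finite_closure_of_not_linearIndependent_pow
          (hdag.not_linearIndependent_pow a)
    have hcenter (a : D) : a ∈ Subring.center D :=
      Subring.mem_center_iff.2 fun x => mul_comm_of_finite_closure hclosure x a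
    exact not_finite_iff_infinite.2 ‹Infinite D›
      (Finite.of_injective (fun a => (⟨a, hcenter a⟩ : Subring.center D))
        fun a b h => congrArg Subtype.val h)
  · exact hdag.rank_center_le
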